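/- For every complex number α with Re(α) < 1, the double integral ∫₀^∞ ∫₀^∞ x^(1−α) e^(−(x+y)²/4) dx dy converges and equals 2^(2−α) Γ((3−α)/2) / (2−α). -/

import Mathlib

open MeasureTheory Set

theorem ofReal_sq_cpow {t : ℝ} (ht : 0 ≤ t) (w : ℂ) :
    ((t : ℂ) ^ 2) ^ w = (t : ℂ) ^ (2 * w) := by
  refine (Complex.cpow_ofNat_mul' ?_ ?_ w).symm <;>
    simp [Complex.arg_ofReal_of_nonneg ht, Real.pi_pos, Real.pi_pos.le]

theorem integral_cpow_mul_exp_neg_sq_div_four {s : ℂ} (hs : -1 < s.re) :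
    ∫ t in Ioi (0 : ℝ), (t : ℂ) ^ s * Complex.exp (-((t : ℂ) ^ 2 / 4))
      = 2 ^ s * Complex.Gamma ((s + 1) / 2) := by
  have hre : 0 < ((s + 1) / 2).re := by
    rw [show (s + 1) / 2 = (s + 1) / ((2 : ℝ) : ℂ) by norm_num, Complex.div_ofReal_re]
    simp only [Complex.add_re, Complex.one_re]
    linarith
  have key := Complex.integral_cpow_mul_exp_neg_mul_Ioi (a := (s + 1) / 2) (r := 1 / 4) hre
    (by norm_num)
  rw [← integral_comp_rpow_Ioi_of_pos (p := 2) two_pos] at key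
  have hcongr : ∀ t ∈ Ioi (0 : ℝ), (2 * t ^ ((2 : ℝ) - 1)) •
      (((t ^ (2 : ℝ) : ℝ) : ℂ) ^ ((s + 1) / 2 - 1) *
        Complex.exp (-(((1 / 4 : ℝ) : ℂ) * ((t ^ (2 : ℝ) : ℝ) : ℂ)))) =
      2 * ((t : ℂ) ^ s * Complex.exp (-((t : ℂ) ^ 2 / 4))) := by
    intro t ht
    have ht : 0 < t := ht
    have htc : (t : ℂ) ≠ 0 := by exact_mod_cast ht.ne'
    have h1 : ((t ^ (2 : ℝ) : ℝ) : ℂ) ^ ((s + 1) / 2 - 1) = (t : ℂ) ^ (s - 1) := by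
      rw [Real.rpow_two, Complex.ofReal_pow, ofReal_sq_cpow ht.le]
      ring_nf
    have h2 : (t : ℂ) ^ s = (t : ℂ) ^ (s - 1) * t := by
      rw [Complex.cpow_sub _ _ htc, Complex.cpow_one]
      field_simp
    rw [h1, h2, Complex.real_smul]
    norm_num
    ring_nf
  rw [setIntegral_congr_fun measurableSet_Ioi hcongr, integral_const_mul] at key
  have h4 : (1 / ((1 / 4 : ℝ) : ℂ)) ^ ((s + 1) / 2) = 2 * 2 ^ s := by
    have h := ofReal_sq_cpow (t := 2) zero_le_two ((s + 1) / 2)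
    rw [Complex.ofReal_ofNat, mul_div_cancel₀ _ two_ne_zero, Complex.cpow_add _ _ two_ne_zero,
      Complex.cpow_one] at h
    rw [mul_comm, ← h]
    norm_num
  rw [h4, mul_assoc] at key
  exact mul_left_cancel₀ two_ne_zero key

theorem integrableOn_cpow_mul_exp_neg_add_sq {s : ℂ} (hs : -1 < s.re) :
    IntegrableOn
      (fun q : ℝ × ℝ => (q.1 : ℂ) ^ s * Complex.exp (-(((q.1 : ℂ) + (q.2 : ℂ)) ^ 2 / 4)))
      (Ioi (0 : ℝ) ×ˢ Ioi (0 : ℝ)) volume := by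
  have h1 : IntegrableOn (fun x : ℝ => x ^ s.re * Real.exp (-(1 / 4) * x ^ 2)) (Ioi 0) :=
    integrableOn_rpow_mul_exp_neg_mul_sq (by norm_num) hs
  have h2 : IntegrableOn (fun x : ℝ => Real.exp (-(1 / 4) * x ^ 2)) (Ioi 0) :=
    (integrable_exp_neg_mul_sq (by norm_num)).integrableOn
  have h3 := h1.integrable.mul_prod h2.integrable
  rw [Measure.prod_restrict, ← Measure.volume_eq_prod] at h3
  refine Integrable.mono' h3 (by fun_prop) ?_
  filter_upwards [ae_restrict_mem (measurableSet_Ioi.prod measurableSet_Ioi)] with q hq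
  obtain ⟨hx, hy⟩ : 0 < q.1 ∧ 0 < q.2 := hq
  have h : Complex.exp (-(((q.1 : ℂ) + (q.2 : ℂ)) ^ 2 / 4))
      = ((Real.exp (-((q.1 + q.2) ^ 2 / 4)) : ℝ) : ℂ) := by push_cast; rfl
  rw [norm_mul, Complex.norm_cpow_eq_rpow_re_of_pos hx, h, Complex.norm_real, Real.norm_eq_abs,
    Real.abs_exp, mul_assoc, ← Real.exp_add]
  gcongr
  nlinarith [mul_pos hx hy]

theorem setIntegral_Ioi_prod_comp_add {E : Type*} [NormedAddCommGroup E] [NormedSpace ℝ E]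
    {g : ℝ → ℝ → E}
    (hg : IntegrableOn (fun q : ℝ × ℝ => g q.1 (q.1 + q.2)) (Ioi (0 : ℝ) ×ˢ Ioi (0 : ℝ))) :
    ∫ q in Ioi (0 : ℝ) ×ˢ Ioi (0 : ℝ), g q.1 (q.1 + q.2)
      = ∫ t in Ioi (0 : ℝ), ∫ x in (0 : ℝ)..t, g x t := by
  have hmp : MeasurePreserving (MeasurableEquiv.shearAddRight ℝ)
      (volume : Measure (ℝ × ℝ)) (volume : Measure (ℝ × ℝ)) :=
    measurePreserving_prod_add volume volume
  have hemb := (MeasurableEquiv.shearAddRight ℝ).measurableEmbedding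
  set T : Set (ℝ × ℝ) := {q | 0 < q.1 ∧ q.1 < q.2} with hT
  have hTm : MeasurableSet T :=
    (measurableSet_lt measurable_const measurable_fst).inter
      (measurableSet_lt measurable_fst measurable_snd)
  have hpre : Ioi (0 : ℝ) ×ˢ Ioi (0 : ℝ) = MeasurableEquiv.shearAddRight ℝ ⁻¹' T := by
    ext q
    simp [hT, MeasurableEquiv.shearAddRight]
  have hfi : IntegrableOn (fun q : ℝ × ℝ => g q.1 q.2) T := by
    rw [← hmp.integrableOn_comp_preimage hemb, ← hpre]
    exact hg
  have hfi' := (integrable_indicator_iff hTm).2 hfi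
  calc ∫ q in Ioi (0 : ℝ) ×ˢ Ioi (0 : ℝ), g q.1 (q.1 + q.2)
      = ∫ q in T, g q.1 q.2 := by
        rw [hpre]
        exact hmp.setIntegral_preimage_emb hemb (fun q => g q.1 q.2) T
    _ = ∫ t, ∫ x, T.indicator (fun q => g q.1 q.2) (x, t) := by
        rw [← integral_indicator hTm, Measure.volume_eq_prod, integral_prod_symm _ hfi']
    _ = ∫ t in Ioi (0 : ℝ), ∫ x in (0 : ℝ)..t, g x t := by
        rw [← integral_indicator measurableSet_Ioi]
        congr 1 with t
        have hslice : (fun x => T.indicator (fun q => g q.1 q.2) (x, t))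
            = (Ioo 0 t).indicator (fun x => g x t) := by
          ext x
          simp [indicator, hT]
        rw [hslice, integral_indicator measurableSet_Ioo]
        by_cases ht : 0 < t
        · rw [indicator_of_mem (mem_Ioi.2 ht), intervalIntegral.integral_of_le ht.le,
            integral_Ioc_eq_integral_Ioo]
        · rw [indicator_of_notMem (by simpa using ht), Ioo_eq_empty ht, setIntegral_empty]

/-- The coefficient integral defining `ε₁,α` in Section 3.2 of the paper. -/
theorem stmt2 (α : ℂ) (hα : α.re < 1) :
    IntegrableOn
      (fun q : ℝ × ℝ => (q.1 : ℂ) ^ (1 - α) * Complex.exp (-(((q.1 : ℂ) + (q.2 : ℂ)) ^ 2 / 4)))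
      (Ioi (0 : ℝ) ×ˢ Ioi (0 : ℝ)) volume ∧
    ∫ q in Ioi (0 : ℝ) ×ˢ Ioi (0 : ℝ),
        (q.1 : ℂ) ^ (1 - α) * Complex.exp (-(((q.1 : ℂ) + (q.2 : ℂ)) ^ 2 / 4))
      = 2 ^ (2 - α) * Complex.Gamma ((3 - α) / 2) / (2 - α) := by
  have hre : -1 < (1 - α).re := by
    simp only [Complex.sub_re, Complex.one_re]
    linarith
  have hne : 2 - α ≠ 0 := by
    intro h
    have := congrArg Complex.re h
    simp at this
    linarith
  have hfi := integrableOn_cpow_mul_exp_neg_add_sq hre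
  refine ⟨hfi, ?_⟩
  have hshear := setIntegral_Ioi_prod_comp_add
    (g := fun x t => (x : ℂ) ^ (1 - α) * Complex.exp (-((t : ℂ) ^ 2 / 4)))
    (by simpa only [Complex.ofReal_add] using hfi)
  simp only [Complex.ofReal_add] at hshear
  rw [hshear]
  have hinner : ∀ t ∈ Ioi (0 : ℝ),
      ∫ x in (0 : ℝ)..t, (x : ℂ) ^ (1 - α) * Complex.exp (-((t : ℂ) ^ 2 / 4))
        = (t : ℂ) ^ (2 - α) * Complex.exp (-((t : ℂ) ^ 2 / 4)) / (2 - α) := by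
    intro t _
    rw [intervalIntegral.integral_mul_const, integral_cpow (Or.inl hre),
      show 1 - α + 1 = 2 - α by ring, Complex.ofReal_zero, Complex.zero_cpow hne, sub_zero]
    ring
  rw [setIntegral_congr_fun measurableSet_Ioi hinner, integral_div,
    integral_cpow_mul_exp_neg_sq_div_four (by simp only [Complex.sub_re, Complex.re_ofNat]; linarith),
    show 2 - α + 1 = 3 - α by ring]
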